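/- Let k, p, t be positive integers with k, p ≥ 2 and t ≤ k − 1. Let T be a tree of height t rooted at a vertex x, let A be the set of vertices of T at distance exactly t from x, and let B be a set of vertices disjoint from V(T). Let G be a bipartite graph with bipartition (A, B). If the graph T ∪ G contains no copy of θ_{k,p}, then e(G) ≤ 2ktp^t · (|A| + |B|). -/

import Mathlib

open SimpleGraph

/-- `G` contains a copy of `H` (an injective graph homomorphism from `H` to `G`). -/
def SimpleGraph.Contains {α β : Type*} (G : SimpleGraph α) (H : SimpleGraph β) : Prop :=
  ∃ f : H →g G, Function.Injective f

/-- The theta graph `θ_{k,p}` (for `k ≥ 2`): `p` internally disjoint paths of length `k`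
joining the two endpoints `Sum.inl false` and `Sum.inl true`; the internal vertices of the
`i`-th path are `(i, 0), …, (i, k-2)`. -/
def thetaGraph (k p : ℕ) : SimpleGraph (Bool ⊕ (Fin p × Fin (k - 1))) :=
  SimpleGraph.fromRel fun x y =>
    match x, y with
    | Sum.inl b, Sum.inr (_, j) => (b = false ∧ (j : ℕ) = 0) ∨ (b = true ∧ (j : ℕ) = k - 2)
    | Sum.inr (i, j), Sum.inr (ii, jj) => i = ii ∧ (jj : ℕ) = (j : ℕ) + 1
    | _, _ => False

/-- A family of `p` internally disjoint paths of length `k` from `z` to `y` yields a copy of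
`θ_{k,p}`. -/
theorem contains_thetaGraph_of_paths {V : Type*} (H : SimpleGraph V) (k p : ℕ) (hk : 2 ≤ k)
    (z y : V) (hzy : z ≠ y) (q : Fin p → ℕ → V) (hz : ∀ i, q i 0 = z) (hy : ∀ i, q i k = y)
    (hadj : ∀ i, ∀ j < k, H.Adj (q i j) (q i (j + 1)))
    (hne : ∀ i j, 1 ≤ j → j < k → q i j ≠ z ∧ q i j ≠ y)
    (hinj : ∀ i i' j j', 1 ≤ j → j < k → 1 ≤ j' → j' < k → q i j = q i' j' → i = i' ∧ j = j') :
    H.Contains (thetaGraph k p) := by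
  let f : Bool ⊕ (Fin p × Fin (k - 1)) → V
    | Sum.inl false => z
    | Sum.inl true => y
    | Sum.inr (i, j) => q i (j + 1)
  have hlast : ∀ (i : Fin p) (j : ℕ), j = k - 2 → H.Adj (q i (j + 1)) y := by
    intro i j hj
    have h := hadj i (j + 1) (by omega)
    rwa [show j + 1 + 1 = k by omega, hy] at h
  have hfirst : ∀ (i : Fin p) (j : ℕ), j = 0 → H.Adj z (q i (j + 1)) := by
    rintro i j rfl
    simpa [hz] using hadj i 0 (by omega)
  refine ⟨⟨f, ?_⟩, ?_⟩
  · rintro ((_ | _) | ⟨i, j⟩) ((_ | _) | ⟨i', j'⟩) h <;>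
      simp only [thetaGraph, SimpleGraph.fromRel_adj] at h <;> obtain ⟨-, h⟩ := h <;>
      simp [f] at h ⊢
    · exact hfirst _ _ (by omega)
    · exact (hlast _ _ (by omega)).symm
    · exact (hfirst _ _ (by omega)).symm
    · exact hlast _ _ (by omega)
    · rcases h with ⟨rfl, h⟩ | ⟨rfl, h⟩
      · rw [h]; exact hadj _ _ (by omega)
      · rw [h]; exact (hadj _ _ (by omega)).symm
  · rintro ((_ | _) | ⟨i, j⟩) ((_ | _) | ⟨i', j'⟩) h <;> simp only [f, RelHom.coeFn_mk] at h
    · rfl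
    · exact absurd h hzy
    · exact absurd h.symm (hne i' _ (by omega) (by omega)).1
    · exact absurd h.symm hzy
    · rfl
    · exact absurd h.symm (hne i' _ (by omega) (by omega)).2
    · exact absurd h (hne i _ (by omega) (by omega)).1
    · exact absurd h (hne i _ (by omega) (by omega)).2
    · obtain ⟨rfl, h⟩ := hinj i i' _ _ (by omega) (by omega) (by omega) (by omega) h
      obtain rfl : j = j' := Fin.ext (by omega)
      rfl

open Finset Classical in
/-- A bipartite graph with more than `d` edges per vertex has a nonempty induced subgraph of
minimum degree greater than `d`. -/
theorem exists_subsets_min_degree {α β : Type*} (R : α → β → Prop) (d : ℕ) (X : Finset α)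
    (Y : Finset β) (h : d * (#X + #Y) < ∑ b ∈ Y, #{a ∈ X | R a b}) :
    ∃ X' ⊆ X, ∃ Y' ⊆ Y, X'.Nonempty ∧ Y'.Nonempty ∧ (∀ a ∈ X', d < #{b ∈ Y' | R a b}) ∧
      ∀ b ∈ Y', d < #{a ∈ X' | R a b} := by
  induction hn : #X + #Y generalizing X Y with
  | zero =>
    have hY : Y = ∅ := by rw [← card_eq_zero]; omega
    simp [hY] at h
  | succ n ih =>
    by_cases hX : ∃ a ∈ X, #{b ∈ Y | R a b} ≤ d
    · obtain ⟨a, ha, had⟩ := hX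
      have hc := card_erase_add_one ha
      obtain ⟨X', hX', Y', hY', hr⟩ := ih (X.erase a) Y (by
        have e₁ := sum_card_bipartiteAbove_eq_sum_card_bipartiteBelow R (s := X) (t := Y)
        have e₂ := sum_card_bipartiteAbove_eq_sum_card_bipartiteBelow R (s := X.erase a) (t := Y)
        simp only [bipartiteAbove, bipartiteBelow] at e₁ e₂
        rw [← e₁, ← add_sum_erase _ _ ha] at h
        rw [← e₂]
        rw [← hc] at h
        nlinarith) (by omega)
      exact ⟨X', hX'.trans (erase_subset _ _), Y', hY', hr⟩
    by_cases hY : ∃ b ∈ Y, #{a ∈ X | R a b} ≤ d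
    · obtain ⟨b, hb, hbd⟩ := hY
      have hc := card_erase_add_one hb
      obtain ⟨X', hX', Y', hY', hr⟩ := ih X (Y.erase b) (by
        rw [← add_sum_erase _ _ hb, ← hc] at h
        nlinarith) (by omega)
      exact ⟨X', hX', Y', hY'.trans (erase_subset _ _), hr⟩
    push Not at hX hY
    obtain ⟨b, hb, hb0⟩ : ∃ b ∈ Y, #{a ∈ X | R a b} ≠ 0 := by
      by_contra! h0
      rw [sum_eq_zero h0] at h
      omega
    obtain ⟨a, ha⟩ := card_ne_zero.1 hb0
    exact ⟨X, Subset.rfl, Y, Subset.rfl, ⟨a, (mem_filter.1 ha).1⟩, ⟨b, hb⟩, hX, hY⟩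

open Finset Classical in
theorem exists_path_avoiding {V : Type*} (H : SimpleGraph V) (S : Finset V) (N : ℕ)
    (hS : ∀ v ∈ S, N < #{w ∈ S | H.Adj v w}) (l : ℕ) (F : Finset V) (hF : #F + l ≤ N + 1)
    (y : V) (hy : y ∈ S) :
    ∃ r : ℕ → V, r 0 = y ∧ (∀ j ≤ l, r j ∈ S) ∧ (∀ j < l, H.Adj (r j) (r (j + 1))) ∧
      (∀ j, 1 ≤ j → j ≤ l → r j ∉ F) ∧
      ∀ i j, 1 ≤ i → i ≤ l → 1 ≤ j → j ≤ l → r i = r j → i = j := by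
  induction l generalizing F y with
  | zero => exact ⟨fun _ => y, rfl, by simp [hy], by simp, by intros; omega, by intros; omega⟩
  | succ l ih =>
    obtain ⟨w, hw, hwF⟩ := exists_mem_notMem_of_card_lt_card
      (lt_of_le_of_lt (show #F ≤ N by omega) (hS y hy))
    rw [mem_filter] at hw
    obtain ⟨r, h0, hrS, hadj, hav, hinj⟩ := ih (insert w F)
      (by rw [card_insert_of_notMem hwF]; omega) w hw.1
    refine ⟨fun j => Nat.casesOn j y r, rfl, ?_, ?_, ?_, ?_⟩
    · rintro (_ | j) hj
      · exact hy
      · exact hrS j (by omega)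
    · rintro (_ | j) hj
      · simpa [h0] using hw.2
      · exact hadj j (by omega)
    · rintro (_ | _ | j) h1 hj
      · omega
      · simpa [h0] using hwF
      · exact fun h => hav (j + 1) (by omega) (by omega) (mem_insert_of_mem h)
    · rintro (_ | _ | i) (_ | _ | j) hi hi' hj hj' h
      any_goals omega
      · exact absurd (by simp [← h0, h]) (hav (j + 1) (by omega) (by omega))
      · exact absurd (by simp [← h0, ← h]) (hav (i + 1) (by omega) (by omega))
      · have := hinj (i + 1) (j + 1) (by omega) (by omega) (by omega) (by omega) h
        omega

open Finset Classical in
/-- A graph of minimum degree greater than `p * l` contains, centred at any given vertex, a spider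
with `p` legs of length `l`. -/
theorem exists_spider {V : Type*} (H : SimpleGraph V) (S : Finset V) (N : ℕ)
    (hS : ∀ v ∈ S, N < #{w ∈ S | H.Adj v w}) (l p : ℕ) (hN : p * l ≤ N) (y : V) (hy : y ∈ S) :
    ∃ r : ℕ → ℕ → V, (∀ i < p, r i 0 = y) ∧ (∀ i < p, ∀ j ≤ l, r i j ∈ S) ∧
      (∀ i < p, ∀ j < l, H.Adj (r i j) (r i (j + 1))) ∧
      (∀ i < p, ∀ j, 1 ≤ j → j ≤ l → r i j ≠ y) ∧
      ∀ i < p, ∀ i' < p, ∀ j j', 1 ≤ j → j ≤ l → 1 ≤ j' → j' ≤ l → r i j = r i' j' →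
        i = i' ∧ j = j' := by
  induction p with
  | zero => exact ⟨fun _ _ => y, by simp, by simp, by simp, by simp, by simp⟩
  | succ p ih =>
    have hp : (p + 1) * l = p * l + l := by ring
    obtain ⟨r, h0, hrS, hadj, hav, hinj⟩ := ih (by omega)
    let F : Finset V := insert y ((range p ×ˢ Icc 1 l).image fun ij => r ij.1 ij.2)
    have hF : #F ≤ p * l + 1 := by
      refine (card_insert_le _ _).trans (Nat.succ_le_succ (card_image_le.trans ?_))
      simp
    have hmem : ∀ i < p, ∀ j, 1 ≤ j → j ≤ l → r i j ∈ F := fun i hi j hj hj' =>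
      mem_insert_of_mem (mem_image.2 ⟨(i, j), by simp [hi, hj, hj'], rfl⟩)
    obtain ⟨u, u0, huS, uadj, uav, uinj⟩ := exists_path_avoiding H S N hS l F (by omega) y hy
    refine ⟨fun i => if i = p then u else r i, ?_, ?_, ?_, ?_, ?_⟩
    · intro i hi
      by_cases h : i = p
      · simp [h, u0]
      · simpa [h] using h0 i (by omega)
    · intro i hi
      by_cases h : i = p
      · simpa [h] using huS
      · simpa [h] using hrS i (by omega)
    · intro i hi
      by_cases h : i = p
      · simpa [h] using uadj
      · simpa [h] using hadj i (by omega)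
    · intro i hi j hj hj'
      by_cases h : i = p
      · simp only [h, if_true]
        exact fun e => uav j hj hj' (by rw [e]; exact mem_insert_self _ _)
      · simpa [h] using hav i (by omega) j hj hj'
    · intro i hi i' hi' j j' hj hjl hj' hjl' e
      by_cases h : i = p <;> by_cases h' : i' = p <;> simp only [h, h', if_true, if_false] at e
      · exact ⟨h.trans h'.symm, uinj j j' hj hjl hj' hjl' e⟩
      · exact absurd (e ▸ hmem i' (by omega) j' hj' hjl') (uav j hj hjl)
      · exact absurd (e ▸ hmem i (by omega) j hj hjl) (uav j' hj' hjl')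
      · exact hinj i (by omega) i' (by omega) j j' hj hjl hj' hjl' e

open Finset Classical in
theorem exists_distinct_representatives {α γ : Type*} (p : ℕ) (g : α → γ) (M : Fin p → Finset α)
    (hM : ∀ i, p ≤ #((M i).image g)) :
    ∃ a : Fin p → α, (∀ i, a i ∈ M i) ∧ Function.Injective fun i => g (a i) := by
  obtain ⟨c, hc, hcM⟩ := (all_card_le_biUnion_card_iff_exists_injective
    fun i => (M i).image g).1 (by
      intro s
      rcases s.eq_empty_or_nonempty with rfl | ⟨i, hi⟩
      · simp
      · exact (card_le_univ s).trans (by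
          simpa using (hM i).trans (card_le_card (subset_biUnion_of_mem (fun i => (M i).image g) hi))))
  choose a haM hac using fun i => mem_image.1 (hcM i)
  exact ⟨a, haM, by simpa only [hac] using hc⟩

/-- `f` behaves as the parent map of a forest in the graph `H` with level function `lev`. -/
structure IsParentMap {α β : Type*} (H : SimpleGraph (α ⊕ β)) (lev : α → ℕ) (f : α → α) :
    Prop where
  adj : ∀ v, lev v ≠ 0 → H.Adj (Sum.inl v) (Sum.inl (f v))
  lev_add_one : ∀ v, lev v ≠ 0 → lev (f v) + 1 = lev v

theorem IsParentMap.lev_iterate {α β : Type*} {H : SimpleGraph (α ⊕ β)} {lev : α → ℕ} {f : α → α}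
    (hf : IsParentMap H lev f) (a : α) (i : ℕ) (hi : i ≤ lev a) :
    lev (f^[i] a) + i = lev a := by
  induction i with
  | zero => rfl
  | succ i ih =>
    have h := ih (by omega)
    have := hf.lev_add_one (f^[i] a) (by omega)
    rw [Function.iterate_succ_apply']
    omega

open Finset Classical in
/-- If every vertex of `Y` keeps neighbours below `p` different children of `z` after the deletion
of few vertices, then a `θ_{k,p}`-free graph has few edges between `X` and `Y`. -/
theorem sum_card_le_of_robust_neighbors {α β : Type*} (H : SimpleGraph (α ⊕ β)) {lev : α → ℕ}
    {f : α → α} (hf : IsParentMap H lev f) (k p t s : ℕ) (hp : 1 ≤ p) (hst : s + 1 ≤ t)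
    (htk : t + 1 ≤ k) (hfree : ¬ H.Contains (thetaGraph k p)) (z : α) (X : Finset α)
    (hX : ∀ a ∈ X, lev a = t ∧ f^[s + 1] a = z) (Y : Finset β)
    (hY : ∀ b ∈ Y, ∀ U : Finset α, #U ≤ p * k →
      p ≤ #(({a ∈ X | H.Adj (Sum.inl a) (Sum.inr b)} \ U).image f^[s])) :
    ∑ b ∈ Y, #{a ∈ X | H.Adj (Sum.inl a) (Sum.inr b)} ≤ (k - 1) * p * (#X + #Y) := by
  by_contra! hlt
  obtain ⟨X', hX', Y', hY', hXne, hYne, hXd, hYd⟩ :=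
    exists_subsets_min_degree (fun a b => H.Adj (Sum.inl a) (Sum.inr b)) _ X Y hlt
  obtain ⟨l, hl⟩ : ∃ l, k = s + 2 + l := ⟨k - (s + 2), by omega⟩
  let K : SimpleGraph (α ⊕ β) := H ⊓ completeBipartiteGraph α β
  let S : Finset (α ⊕ β) := X'.disjSum Y'
  have hS : ∀ v ∈ S, (k - 1) * p < #{w ∈ S | K.Adj v w} := by
    rintro (a | b) hv
    · refine (hXd a (by simpa [S] using hv)).trans_le ?_
      rw [← card_map Function.Embedding.inr]
      refine card_le_card fun w hw => ?_
      obtain ⟨b, hb, rfl⟩ := mem_map.1 hw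
      simpa [S, K] using hb
    · refine (hYd b (by simpa [S] using hv)).trans_le ?_
      rw [← card_map Function.Embedding.inl]
      refine card_le_card fun w hw => ?_
      obtain ⟨a, ha, rfl⟩ := mem_map.1 hw
      simpa [S, K, H.adj_comm] using ha
  obtain ⟨y, hyS, hypar⟩ : ∃ y ∈ S, y.isRight = decide (Even l) := by
    obtain ⟨a, ha⟩ := hXne
    obtain ⟨b, hb⟩ := hYne
    by_cases hev : Even l
    · exact ⟨Sum.inr b, by simpa [S] using hb, by simp [hev]⟩
    · exact ⟨Sum.inl a, by simpa [S] using ha, by simp [hev]⟩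
  have hpl : p * l ≤ (k - 1) * p := by
    rw [mul_comm]; exact Nat.mul_le_mul_right _ (by omega)
  obtain ⟨r, hr0, hrS, hradj, hrne, hrinj⟩ := exists_spider K S ((k - 1) * p)
    (fun v hv => by convert hS v hv) l p hpl y hyS
  have hside : ∀ i < p, ∀ j ≤ l, (r i j).isRight = decide (Even (l + j)) := by
    intro i hi j
    induction j with
    | zero => intro _; simpa [hr0 i hi] using hypar
    | succ j ih =>
      intro hj
      have h₁ := ih (by omega)
      have h₂ := hradj i hi j (by omega)
      rw [← add_assoc]
      rcases hu : r i j with u | u <;> rcases hw : r i (j + 1) with w | w <;>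
        rw [hu, hw] at h₂ <;> rw [hu] at h₁ <;> simp [K] at h₁ h₂ ⊢ <;> grind
  have hend : ∀ i : Fin p, ∃ b ∈ Y, r i l = Sum.inr b := by
    intro i
    have h₁ := hside i i.2 l le_rfl
    have h₂ := hrS i i.2 l le_rfl
    rcases hu : r i l with u | u
    · simp [hu] at h₁
    · rw [hu] at h₂
      exact ⟨u, hY' (by simpa [S] using h₂), rfl⟩
  choose b hbY hb using hend
  let U : Finset α := (insert y ((range p ×ˢ Icc 1 l).image fun ij => r ij.1 ij.2)).toLeft
  have hU : #U ≤ p * k := by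
    refine card_toLeft_le.trans ((card_insert_le _ _).trans ?_)
    have h₁ : #((range p ×ˢ Icc 1 l).image fun ij => r ij.1 ij.2) ≤ p * l :=
      card_image_le.trans (by simp)
    have h₂ : p * k = p * l + p * (s + 2) := by rw [hl]; ring
    have h₃ : 1 ≤ p * (s + 2) := Nat.mul_pos hp (by omega)
    omega
  have hrU : ∀ i < p, ∀ j ≤ l, ∀ a, r i j = Sum.inl a → a ∈ U := by
    intro i hi j hj a ha
    rw [mem_toLeft, ← ha]
    rcases Nat.eq_zero_or_pos j with rfl | hj0
    · rw [hr0 i hi]; exact mem_insert_self _ _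
    · exact mem_insert_of_mem (mem_image.2 ⟨(i, j), by simp; omega, rfl⟩)
  have hrX : ∀ i < p, ∀ j ≤ l, ∀ a, r i j = Sum.inl a → lev a = t := by
    intro i hi j hj a ha
    have h := hrS i hi j hj
    rw [ha] at h
    exact (hX a (hX' (by simpa [S] using h))).1
  obtain ⟨a, haM, hainj⟩ := exists_distinct_representatives p f^[s] _
    fun i => hY (b i) (hbY i) U hU
  simp only [mem_sdiff, mem_filter] at haM
  have hlev : ∀ i, ∀ m ≤ s + 1, lev (f^[m] (a i)) + m = t := by
    intro i m hm
    have := (hX _ (haM i).1.1).1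
    rw [hf.lev_iterate _ _ (by omega), this]
  have hroot : ∀ i, f^[s + 1] (a i) = z := fun i => (hX _ (haM i).1.1).2
  have hzlev : lev z < t := by
    have h := hlev ⟨0, hp⟩ (s + 1) le_rfl
    rw [hroot] at h
    omega
  have hzr : ∀ i < p, ∀ j ≤ l, r i j ≠ Sum.inl z := fun i hi j hj h =>
    hzlev.ne (hrX i hi j hj z h)
  have htree : ∀ i : Fin p, ∀ m ≤ s, ∀ i' < p, ∀ j ≤ l, Sum.inl (f^[m] (a i)) ≠ r i' j := by
    intro i m hm i' hi' j hj h
    have h₁ := hrX i' hi' j hj _ h.symm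
    have h₂ := hlev i m (by omega)
    obtain rfl : m = 0 := by omega
    exact (haM i).2 (hrU i' hi' j hj _ h.symm)
  let q : Fin p → ℕ → α ⊕ β := fun i j =>
    if j ≤ s + 1 then Sum.inl (f^[s + 1 - j] (a i)) else r i (k - j)
  have hq₁ : ∀ i j, j ≤ s + 1 → q i j = Sum.inl (f^[s + 1 - j] (a i)) := fun i j h => if_pos h
  have hq₂ : ∀ i j, ¬ j ≤ s + 1 → q i j = r i (k - j) := fun i j h => if_neg h
  refine hfree (contains_thetaGraph_of_paths H k p (by omega) (Sum.inl z) y ?_ q ?_ ?_ ?_ ?_ ?_)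
  · rw [← hr0 0 hp]
    exact (hzr 0 hp 0 (by omega)).symm
  · intro i
    rw [hq₁ i 0 (by omega), Nat.sub_zero, hroot]
  · intro i
    rw [hq₂ i k (by omega), Nat.sub_self, hr0 i i.2]
  · intro i j hj
    rcases lt_trichotomy j (s + 1) with h | rfl | h
    · rw [hq₁ i j (by omega), hq₁ i (j + 1) (by omega),
        show s + 1 - j = s + 1 - (j + 1) + 1 by omega, Function.iterate_succ_apply']
      have := hlev i (s + 1 - (j + 1)) (by omega)
      exact (hf.adj _ (by omega)).symm
    · rw [hq₁ i _ le_rfl, hq₂ i _ (by omega), Nat.sub_self, show k - (s + 1 + 1) = l by omega, hb]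
      exact (haM i).1.2
    · rw [hq₂ i _ (by omega), hq₂ i _ (by omega), show k - j = k - (j + 1) + 1 by omega]
      exact (hradj i i.2 _ (by omega)).1.symm
  · intro i j hj hjk
    by_cases h : j ≤ s + 1
    · rw [hq₁ i j h]
      refine ⟨fun e => ?_, ?_⟩
      · have h₁ := hlev i (s + 1 - j) (by omega)
        have h₂ := hlev i (s + 1) le_rfl
        rw [Sum.inl.inj e] at h₁
        rw [hroot] at h₂
        omega
      · rw [← hr0 0 hp]
        exact htree i _ (by omega) 0 hp 0 (by omega)
    · rw [hq₂ i j h]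
      exact ⟨hzr i i.2 _ (by omega), hrne i i.2 _ (by omega) (by omega)⟩
  · intro i i' j j' hj hjk hj' hjk' e
    by_cases h : j ≤ s + 1 <;> by_cases h' : j' ≤ s + 1
    · rw [hq₁ i j h, hq₁ i' j' h'] at e
      have e := Sum.inl.inj e
      have h₁ := hlev i (s + 1 - j) (by omega)
      have h₂ := hlev i' (s + 1 - j') (by omega)
      rw [e] at h₁
      obtain rfl : j = j' := by omega
      refine ⟨hainj ?_, rfl⟩
      have e' := congrArg f^[j - 1] e
      rwa [← Function.iterate_add_apply, ← Function.iterate_add_apply,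
        show j - 1 + (s + 1 - j) = s by omega] at e'
    · rw [hq₁ i j h, hq₂ i' j' h'] at e
      exact absurd e (htree i _ (by omega) i' i'.2 _ (by omega))
    · rw [hq₂ i j h, hq₁ i' j' h'] at e
      exact absurd e.symm (htree i' _ (by omega) i i.2 _ (by omega))
    · rw [hq₂ i j h, hq₂ i' j' h'] at e
      have := hrinj i i.2 i' i'.2 _ _ (by omega) (by omega) (by omega) (by omega) e
      exact ⟨Fin.ext this.1, by omega⟩

/-- The edge density permitted below a vertex that lies `s` levels above the leaves. -/
def levelBound (k p : ℕ) : ℕ → ℕ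
  | 0 => 1
  | s + 1 => p * levelBound k p s + p * k + (k - 1) * p

theorem levelBound_succ_le (k p : ℕ) (hk : 2 ≤ k) (hp : 1 ≤ p) (s : ℕ) :
    levelBound k p (s + 1) ≤ 2 * k * (s + 1) * p ^ (s + 1) := by
  obtain ⟨k, rfl⟩ : ∃ m, k = m + 1 := ⟨k - 1, by omega⟩
  induction s with
  | zero => simp only [levelBound, Nat.add_sub_cancel]; apply le_of_eq; ring
  | succ s ih =>
    rw [levelBound, Nat.add_sub_cancel]
    have h₁ : p ≤ p ^ (s + 1 + 1) := Nat.le_self_pow (by omega) p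
    have h₂ := Nat.mul_le_mul_left p ih
    have h₃ : p * (2 * (k + 1) * (s + 1) * p ^ (s + 1)) =
      2 * (k + 1) * (s + 1) * p ^ (s + 1 + 1) := by ring
    have h₄ := Nat.mul_le_mul_left (2 * (k + 1)) h₁
    nlinarith

open Finset Classical in
/-- If, outside a set of at most `m` vertices, the neighbours of every `b ∈ Y` lie in fewer than
`p` fibres of `g`, then a density bound on the fibres gives a density bound on the whole graph. -/
theorem sum_card_le_of_few_fibers {α β : Type*} (R : α → β → Prop) (g : α → α) (c m p : ℕ)
    (X : Finset α) (Y : Finset β) (hp : 1 ≤ p)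
    (hfib : ∀ w, ∀ Z : Finset β, ∑ b ∈ Z, #{a ∈ {a ∈ X | g a = w} | R a b} ≤
      c * (#{a ∈ X | g a = w} + #Z))
    (hY : ∀ b ∈ Y, ∃ U : Finset α, #U ≤ m ∧ #(({a ∈ X | R a b} \ U).image g) < p) :
    ∑ b ∈ Y, #{a ∈ X | R a b} ≤ (p * c + m) * (#X + #Y) := by
  choose! U hUm hUp using hY
  let C : β → Finset α := fun b => ({a ∈ X | R a b} \ U b).image g
  have hCX : ∀ b, C b ⊆ X.image g := fun b =>
    image_subset_image (sdiff_subset.trans (filter_subset _ _))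
  have hdeg : ∀ b ∈ Y, #{a ∈ X | R a b} ≤
      m + ∑ w ∈ C b, #{a ∈ {a ∈ X | g a = w} | R a b} := by
    intro b hb
    have h₁ : #{a ∈ X | R a b} ≤ #({a ∈ X | R a b} \ U b) + #(U b) := by
      have := le_card_sdiff (U b) {a ∈ X | R a b}
      omega
    have h₂ : #({a ∈ X | R a b} \ U b) ≤ ∑ w ∈ C b, #{a ∈ {a ∈ X | g a = w} | R a b} := by
      rw [card_eq_sum_card_image g]
      refine sum_le_sum fun w _ => card_le_card fun a ha => ?_
      simp only [mem_filter, mem_sdiff] at ha ⊢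
      tauto
    have := hUm b hb
    omega
  have hswap : ∀ F : β → α → ℕ, ∑ b ∈ Y, ∑ w ∈ C b, F b w =
      ∑ w ∈ X.image g, ∑ b ∈ Y with w ∈ C b, F b w := by
    intro F
    refine sum_comm' fun b w => ?_
    simp only [mem_filter]
    exact ⟨fun h => ⟨h, hCX b h.2⟩, fun h => h.1⟩
  have hcount : ∑ w ∈ X.image g, #{b ∈ Y | w ∈ C b} ≤ p * #Y := by
    have h := hswap fun _ _ => 1
    simp only [sum_const, smul_eq_mul, mul_one] at h
    rw [← h, mul_comm]
    exact sum_le_card_nsmul _ _ _ fun b hb => (hUp b hb).le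
  calc ∑ b ∈ Y, #{a ∈ X | R a b}
      ≤ ∑ b ∈ Y, (m + ∑ w ∈ C b, #{a ∈ {a ∈ X | g a = w} | R a b}) := sum_le_sum hdeg
    _ = #Y * m + ∑ w ∈ X.image g, ∑ b ∈ Y with w ∈ C b, #{a ∈ {a ∈ X | g a = w} | R a b} := by
        rw [sum_add_distrib, hswap, sum_const, smul_eq_mul]
    _ ≤ #Y * m + ∑ w ∈ X.image g, c * (#{a ∈ X | g a = w} + #{b ∈ Y | w ∈ C b}) := by
        gcongr
        exact hfib _ _
    _ = #Y * m + c * (#X + ∑ w ∈ X.image g, #{b ∈ Y | w ∈ C b}) := by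
        rw [← mul_sum, sum_add_distrib, ← card_eq_sum_card_image]
    _ ≤ #Y * m + c * (p * #X + p * #Y) := by
        gcongr
        exact Nat.le_mul_of_pos_left _ hp
    _ ≤ (p * c + m) * (#X + #Y) := by nlinarith [Nat.zero_le (m * #X)]

open Finset Classical in
theorem sum_card_le_levelBound {α β : Type*} [Fintype α] (H : SimpleGraph (α ⊕ β))
    {lev : α → ℕ} {f : α → α} (hf : IsParentMap H lev f) (k p t : ℕ) (hp : 1 ≤ p)
    (htk : t + 1 ≤ k) (hfree : ¬ H.Contains (thetaGraph k p)) (s : ℕ) (hst : s ≤ t) (z : α)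
    (Y : Finset β) :
    ∑ b ∈ Y, #{a ∈ ({a | lev a = t ∧ f^[s] a = z} : Finset α) | H.Adj (Sum.inl a) (Sum.inr b)} ≤
      levelBound k p s * (#{a | lev a = t ∧ f^[s] a = z} + #Y) := by
  induction s generalizing z Y with
  | zero =>
    have h : ∀ b ∈ Y, #{a ∈ ({a | lev a = t ∧ f^[0] a = z} : Finset α) |
        H.Adj (Sum.inl a) (Sum.inr b)} ≤ 1 := by
      intro b _
      refine card_le_one.2 fun a ha a' ha' => ?_
      have e := (mem_filter.1 (mem_filter.1 ha).1).2.2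
      exact e.trans (mem_filter.1 (mem_filter.1 ha').1).2.2.symm
    have := sum_le_card_nsmul _ _ _ h
    simp only [smul_eq_mul, mul_one] at this
    simp only [levelBound, one_mul]
    omega
  | succ s ih =>
    set X : Finset α := {a | lev a = t ∧ f^[s + 1] a = z} with hXdef
    let robust : β → Prop := fun b => ∀ U : Finset α, #U ≤ p * k →
      p ≤ #(({a ∈ X | H.Adj (Sum.inl a) (Sum.inr b)} \ U).image f^[s])
    have h₁ := sum_card_le_of_robust_neighbors H hf k p t s hp hst htk hfree z X
      (fun a ha => (mem_filter.1 ha).2) {b ∈ Y | robust b} fun b hb => (mem_filter.1 hb).2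
    have h₂ := sum_card_le_of_few_fibers (fun a b => H.Adj (Sum.inl a) (Sum.inr b)) f^[s]
      (levelBound k p s) (p * k) p X {b ∈ Y | ¬ robust b} hp
      (by
        intro w Z
        by_cases hw : f w = z
        · have hX : ({a ∈ X | f^[s] a = w} : Finset α) =
              ({a | lev a = t ∧ f^[s] a = w} : Finset α) := by
            ext a
            rw [mem_filter, hXdef, mem_filter, mem_filter, Function.iterate_succ_apply']
            simp only [mem_univ, true_and]
            constructor
            · exact fun h => ⟨h.1.1, h.2⟩
            · exact fun h => ⟨⟨h.1, by rw [h.2, hw]⟩, h.2⟩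
          rw [hX]
          exact ih (by omega) w Z
        · have hX : ({a ∈ X | f^[s] a = w} : Finset α) = ∅ := by
            refine filter_eq_empty_iff.2 fun a ha e => hw ?_
            rw [hXdef, mem_filter, Function.iterate_succ_apply', e] at ha
            exact ha.2.2
          simp [hX])
      (fun b hb => by
        have h := (mem_filter.1 hb).2
        simp only [robust] at h
        push Not at h
        exact h)
    rw [← sum_filter_add_sum_filter_not Y robust]
    have hle₁ : #{b ∈ Y | robust b} ≤ #Y := card_filter_le _ _
    have hle₂ : #{b ∈ Y | ¬ robust b} ≤ #Y := card_filter_le _ _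
    calc _ ≤ _ := add_le_add h₁ h₂
      _ ≤ (k - 1) * p * (#X + #Y) + (p * levelBound k p s + p * k) * (#X + #Y) := by gcongr
      _ = _ := by rw [levelBound]; ring

theorem exists_adj_dist_add_one_eq {α : Type*} {T : SimpleGraph α} (hT : T.Connected) (x v : α)
    (hv : T.dist x v ≠ 0) : ∃ w, T.Adj v w ∧ T.dist x w + 1 = T.dist x v := by
  obtain ⟨W, hW⟩ := hT.exists_walk_length_eq_dist v x
  cases W with
  | nil => simp at hv
  | cons h W =>
    rename_i w
    refine ⟨w, h, ?_⟩
    have h₁ := SimpleGraph.dist_le W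
    have h₂ := hT.dist_triangle (u := v) (v := w) (w := x)
    have h₃ : T.dist v w = 1 := SimpleGraph.dist_eq_one_iff_adj.2 h
    rw [SimpleGraph.Walk.length_cons] at hW
    rw [SimpleGraph.dist_comm (u := x) (v := w), SimpleGraph.dist_comm (u := x) (v := v)]
    omega

/-- Let `k, p ≥ 2` and `1 ≤ t ≤ k - 1`.  Let `T` be a tree of height `t` rooted at `x`, let
`A` be the set of vertices of `T` at distance exactly `t` from `x`, and let `B` (modelled by
the type `β`) be a set of vertices disjoint from `V(T)`.  Let `G` be a bipartite graph with
bipartition `(A, B)`.  If the union `T ∪ G` contains no copy of `θ_{k,p}`, then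
`e(G) ≤ 2ktp^t (|A| + |B|)`. -/
theorem asymm_theta_level_lemma {α β : Type*} [Fintype α] [Fintype β]
    (k p t : ℕ) (hk : 2 ≤ k) (hp : 2 ≤ p) (ht : 1 ≤ t) (htk : t ≤ k - 1)
    (T : SimpleGraph α) (hT : T.IsTree) (x : α) (hheight : ∀ v : α, T.dist x v ≤ t)
    (G : SimpleGraph (α ⊕ β))
    (hbip : ∀ ⦃u v⦄, G.Adj u v → ∃ a b, T.dist x a = t ∧
      ((u = Sum.inl a ∧ v = Sum.inr b) ∨ (u = Sum.inr b ∧ v = Sum.inl a)))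
    (hfree : ¬ (T.map Function.Embedding.inl ⊔ G).Contains (thetaGraph k p)) :
    (G.edgeSet.ncard : ℝ) ≤ 2 * k * t * (p : ℝ) ^ t *
      (({a : α | T.dist x a = t}.ncard : ℝ) + (Fintype.card β : ℝ)) := by
  classical
  obtain ⟨f, hf⟩ : ∃ f : α → α, ∀ v, T.dist x v ≠ 0 →
      T.Adj v (f v) ∧ T.dist x (f v) + 1 = T.dist x v := by
    choose! f hf using exists_adj_dist_add_one_eq hT.connected x
    exact ⟨f, hf⟩
  set H := T.map Function.Embedding.inl ⊔ G with hH
  have hpar : IsParentMap H (T.dist x) f :=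
    ⟨fun v hv => Or.inl ((SimpleGraph.map_adj_apply (f := Function.Embedding.inl)).2 (hf v hv).1),
      fun v hv => (hf v hv).2⟩
  have hroot : ∀ a, T.dist x a = t → f^[t] a = x := by
    intro a ha
    have h := hpar.lev_iterate a t ha.ge
    exact ((hT.connected.dist_eq_zero_iff).1 (by omega)).symm
  have hA : ({a | T.dist x a = t ∧ f^[t] a = x} : Finset α) =
      ({a | T.dist x a = t} : Finset α) :=
    Finset.filter_congr fun a _ => ⟨fun h => h.1, fun h => ⟨h, hroot a h⟩⟩
  have hmain := sum_card_le_levelBound H hpar k p t (by omega) (by omega) hfree t le_rfl x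
    Finset.univ
  rw [Finset.filter_congr_decidable, hA] at hmain
  have hedge : G.edgeSet.ncard ≤ ∑ b : β, Finset.card
      {a ∈ ({a | T.dist x a = t} : Finset α) | H.Adj (Sum.inl a) (Sum.inr b)} := by
    rw [← Finset.card_sigma, ← Set.ncard_coe_finset]
    refine (Set.ncard_le_ncard ?_ ((Finset.finite_toSet _).image
      fun e : (_ : β) × α => s(Sum.inl e.2, Sum.inr e.1))).trans
      (Set.ncard_image_le (Finset.finite_toSet _))
    intro e
    induction e using Sym2.ind with
    | _ u v =>
      intro huv
      rw [SimpleGraph.mem_edgeSet] at huv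
      obtain ⟨a, b, ha, ⟨rfl, rfl⟩ | ⟨rfl, rfl⟩⟩ := hbip huv
      · exact ⟨⟨b, a⟩, by simp [ha, hH, huv], rfl⟩
      · exact ⟨⟨b, a⟩, by simp [ha, hH, huv.symm], Sym2.eq_swap⟩
  obtain ⟨s, rfl⟩ : ∃ s, t = s + 1 := ⟨t - 1, by omega⟩
  have hfinal : G.edgeSet.ncard ≤ 2 * k * (s + 1) * p ^ (s + 1) *
      ({a : α | T.dist x a = s + 1}.ncard + Fintype.card β) := by
    have hcard : {a : α | T.dist x a = s + 1}.ncard =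
        Finset.card {a : α | T.dist x a = s + 1} := by
      rw [← Set.ncard_coe_finset]
      simp
    rw [hcard]
    refine (hedge.trans (le_of_eq_of_le ?_ hmain)).trans
      (Nat.mul_le_mul_right _ (levelBound_succ_le k p hk (by omega) s))
    exact Finset.sum_congr rfl fun b _ => by congr
  exact_mod_cast hfinal
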